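/- arXiv:1703.01986 — 2 statements merged into one kernel-verified Lean document; each statement's English description precedes it below -/
import Mathlib

section
/- Let l be a list of real numbers, let m < n be valid indices of l with l(m) ≥ l(n), and let l' be the list obtained from l by exchanging the entries at positions m and n. Then for every k, the prefix sum ∑_{i<k} l'(i) is at most the prefix sum ∑_{i<k} l(i), while the total sums of l and l' are equal. -/
theorem take_set_sum_aux (l : List ℝ) (i : ℕ) (hi : i < l.length) (a : ℝ) (k : ℕ) :
    ((l.set i a).take k).sum = (l.take k).sum + if i < k then a - l[i] else 0 := by
  induction l generalizing i k with
  | nil => simp at hi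
  | cons x t ih =>
    cases k with
    | zero => simp
    | succ k =>
      cases i with
      | zero => simp; ring
      | succ i =>
        have hi2 : i < t.length := by simpa using hi
        simp [ih i hi2 k, add_assoc]

/-- **Exchange step.** If `m < n` are valid indices of a list `l` of reals with
`l(m) ≥ l(n)`, and `l'` is obtained from `l` by exchanging the entries at
positions `m` and `n`, then every prefix sum of `l'` is at most the
corresponding prefix sum of `l`, while the total sums coincide. -/
theorem prefixSum_swap_le (l : List ℝ) (m n : ℕ) (hmn : m < n) (hn : n < l.length)
    (hge : l[n]'hn ≤ l[m]'(hmn.trans hn)) :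
    (∀ k : ℕ,
        ((((l.set m (l[n]'hn)).set n (l[m]'(hmn.trans hn))).take k).sum ≤ ((l.take k).sum)))
    ∧ ((l.set m (l[n]'hn)).set n (l[m]'(hmn.trans hn))).sum = l.sum := by
  have key : ∀ k : ℕ,
      (((l.set m (l[n]'hn)).set n (l[m]'(hmn.trans hn))).take k).sum
        = (l.take k).sum + (if m < k then l[n]'hn - l[m]'(hmn.trans hn) else 0)
          + (if n < k then l[m]'(hmn.trans hn) - l[n]'hn else 0) := by
    intro k
    rw [take_set_sum_aux _ n (by simpa using hn), take_set_sum_aux l m (hmn.trans hn),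
      List.getElem_set_ne (by omega)]
  constructor
  · intro k
    rw [key k]
    split_ifs <;> first | omega | linarith
  · have h := key l.length
    rw [if_pos (hmn.trans hn), if_pos hn, List.take_of_length_le (by simp),
      List.take_length] at h
    linarith
end

section
/- In the video download model, let m < n be indices with b(m) ≥ b(n) and let b' be the strategy obtained from b by exchanging the bitrates of segments m and n. Then for every time t ∈ ℕ, the downloaded-segment count satisfies D_{b'}(t) ≥ D_b(t), where D_b(t) is the largest k with 0 ≤ k ≤ S such that c·∑_{s<k} b(s) ≤ R(t). In particular, if b incurs no buffer underflow with respect to a given playback deadline schedule, neither does b'. -/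
/-- The download completion time of the first `k` segments under bitrate strategy `b`:
the least time `t : ℕ` with `R t ≥ c * ∑_{s<k} b(s)`. -/
noncomputable def downloadTime (R : ℕ → ℝ) (c : ℝ) (b : List ℝ) (k : ℕ) : ℕ :=
  sInf {t : ℕ | c * ((b.take k).sum) ≤ R t}

/-- The downloaded-segment count at time `t` under bitrate strategy `b`:
the largest `k` with `0 ≤ k ≤ S` such that `c * ∑_{s<k} b(s) ≤ R t`. -/
noncomputable def downloadedCount (R : ℕ → ℝ) (c : ℝ) (b : List ℝ) (t : ℕ) : ℕ :=
  sSup {k : ℕ | k ≤ b.length ∧ c * ((b.take k).sum) ≤ R t}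

theorem sum_take_set_aux (l : List ℝ) : ∀ (i k : ℕ) (x : ℝ) (hi : i < l.length),
    ((l.set i x).take k).sum = (l.take k).sum + if i < k then x - l[i] else 0 := by
  induction l with
  | nil => intro i k x hi; simp at hi
  | cons a l ih =>
    intro i k x hi
    cases k with
    | zero => simp <;> ring
    | succ k =>
      cases i with
      | zero => simp <;> ring
      | succ i =>
        have h := ih i k x (by simpa using hi)
        simp only [List.set_cons_succ, List.take_succ_cons, List.sum_cons, h,
          List.getElem_cons_succ, Nat.add_lt_add_iff_right]
        ring

/-- **Single-swap relaxation.** In the video download model, if `m < n` are valid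
segment indices with `b(m) ≥ b(n)` and `b'` is obtained from `b` by exchanging the
bitrates of segments `m` and `n`, then at every time `t` the downloaded-segment
count under `b'` is at least that under `b`; in particular, if `b` meets a given
playback deadline schedule `d` (no buffer underflow), then so does `b'`. -/
theorem downloadedCount_swap_ge (R : ℕ → ℝ) (hmono : Monotone R) (hR0 : R 0 = 0)
    (htop : Filter.Tendsto R Filter.atTop Filter.atTop)
    (c : ℝ) (hc : 0 < c) (b : List ℝ) (hnn : ∀ x ∈ b, 0 ≤ x)
    (m n : ℕ) (hmn : m < n) (hn : n < b.length)
    (hge : b[n]'hn ≤ b[m]'(hmn.trans hn))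
    (b' : List ℝ) (hb' : b' = (b.set m (b[n]'hn)).set n (b[m]'(hmn.trans hn))) :
    (∀ t : ℕ, downloadedCount R c b t ≤ downloadedCount R c b' t)
    ∧ (∀ d : ℕ → ℕ,
        (∀ k : ℕ, k ≤ b.length → downloadTime R c b k ≤ d k) →
        (∀ k : ℕ, k ≤ b'.length → downloadTime R c b' k ≤ d k)) := by
  have hlen : b'.length = b.length := by simp [hb']
  have key : ∀ k, (b'.take k).sum ≤ (b.take k).sum := by
    intro k
    rw [hb', sum_take_set_aux _ n k _ (by simpa using hn),
      sum_take_set_aux b m k _ (hmn.trans hn), List.getElem_set_ne (by omega)]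
    split_ifs <;> first | omega | linarith
  have key2 : ∀ k t, c * (b.take k).sum ≤ R t → c * (b'.take k).sum ≤ R t := fun k t h =>
    (mul_le_mul_of_nonneg_left (key k) hc.le).trans h
  refine ⟨fun t => ?_, fun d hd k hk => ?_⟩
  · unfold downloadedCount
    refine csSup_le_csSup ⟨b'.length, fun k hk => hk.1⟩ ⟨0, ?_⟩ ?_
    · refine ⟨Nat.zero_le _, ?_⟩
      simpa [hR0] using hmono (Nat.zero_le t)
    · rintro k ⟨h1, h2⟩
      exact ⟨hlen ▸ h1, key2 k t h2⟩
  · refine le_trans ?_ (hd k (hlen ▸ hk))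
    have hne : {t : ℕ | c * (b.take k).sum ≤ R t}.Nonempty :=
      (htop.eventually_ge_atTop (c * (b.take k).sum)).exists
    exact Nat.sInf_le (key2 k _ (Nat.sInf_mem hne))
end
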